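/- Let R > 0, T = π/4, and let B, F, G : ℝ → ℝ coincide with the identity on [−R, R]. Let (Ω, 𝓕, P) be a probability space and let W : [0, T] → Ω → ℝ be a family of integrable random variables with E[W_t] = 0 for all t and W_0 = 0. Then uniqueness fails for the mean-field forward–backward system X_t = ∫₀ᵗ B(E[Y_s]) ds + W_t, Y_t = G(E[X_T]) + ∫ₜ^T F(E[X_s]) ds: there exist two pairs of processes (X, Y) and (X', Y'), both satisfying this system for all t ∈ [0, T] with the same initial condition X_0 = X'_0 = 0, such that E[Y_0] ≠ E[Y'_0] (for instance the solutions associated with A = 0 and A = R, namely X_t = A·sin(t) + W_t, Y_t = A·cos(t)). -/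

import Mathlib

open MeasureTheory Real Set

/-- Failure of uniqueness for the mean-field forward-backward system
`X t = ∫₀ᵗ B(E[Y s]) ds + W t`, `Y t = G(E[X T]) + ∫ₜᵀ F(E[X s]) ds` on `[0, T]`
with `T = π/4`: there exist two pairs of processes `(X, Y)` and `(X', Y')`, both
solving the system with the same initial condition `X 0 = X' 0 = 0`, such that
`E[Y 0] ≠ E[Y' 0]`. -/
theorem stmt_3 {Ω : Type*} [MeasurableSpace Ω] (P : Measure Ω) [IsProbabilityMeasure P]
    (R : ℝ) (hR : 0 < R) (B F G : ℝ → ℝ)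
    (hB : ∀ v : ℝ, |v| ≤ R → B v = v)
    (hF : ∀ v : ℝ, |v| ≤ R → F v = v)
    (hG : ∀ v : ℝ, |v| ≤ R → G v = v)
    (W : ℝ → Ω → ℝ)
    (hWint : ∀ t ∈ Set.Icc (0 : ℝ) (Real.pi / 4), Integrable (W t) P)
    (hWmean : ∀ t ∈ Set.Icc (0 : ℝ) (Real.pi / 4), ∫ ω, W t ω ∂P = 0)
    (hW0 : ∀ ω, W 0 ω = 0) :
    ∃ X Y X' Y' : ℝ → Ω → ℝ,
      (∀ t ∈ Set.Icc (0 : ℝ) (Real.pi / 4), ∀ ω,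
        X t ω = (∫ s in (0 : ℝ)..t, B (∫ ω', Y s ω' ∂P)) + W t ω ∧
        Y t ω = G (∫ ω', X (Real.pi / 4) ω' ∂P)
          + ∫ s in t..(Real.pi / 4), F (∫ ω', X s ω' ∂P)) ∧
      (∀ t ∈ Set.Icc (0 : ℝ) (Real.pi / 4), ∀ ω,
        X' t ω = (∫ s in (0 : ℝ)..t, B (∫ ω', Y' s ω' ∂P)) + W t ω ∧
        Y' t ω = G (∫ ω', X' (Real.pi / 4) ω' ∂P)
          + ∫ s in t..(Real.pi / 4), F (∫ ω', X' s ω' ∂P)) ∧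
      (∀ ω, X 0 ω = 0) ∧ (∀ ω, X' 0 ω = 0) ∧
      (∫ ω, Y 0 ω ∂P) ≠ ∫ ω, Y' 0 ω ∂P := by
  have hpi : (0 : ℝ) ≤ Real.pi / 4 := by positivity
  have key : ∀ A : ℝ, |A| ≤ R → ∀ t ∈ Set.Icc (0 : ℝ) (Real.pi / 4), ∀ ω,
      A * Real.sin t + W t ω
        = (∫ s in (0 : ℝ)..t, B (∫ _ω' : Ω, A * Real.cos s ∂P)) + W t ω ∧
      A * Real.cos t = G (∫ ω', (A * Real.sin (Real.pi / 4) + W (Real.pi / 4) ω') ∂P)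
          + ∫ s in t..(Real.pi / 4), F (∫ ω', (A * Real.sin s + W s ω') ∂P) := by
    intro A hA t ht ω
    have hmul : ∀ c : ℝ, |c| ≤ 1 → |A * c| ≤ R := by
      intro c hc
      rw [abs_mul]
      nlinarith [abs_nonneg A, abs_nonneg c]
    have hmean : ∀ s ∈ Set.Icc (0 : ℝ) (Real.pi / 4),
        ∫ ω', (A * Real.sin s + W s ω') ∂P = A * Real.sin s := by
      intro s hs
      rw [integral_add (integrable_const _) (hWint s hs), hWmean s hs]
      simp
    constructor
    · have h1 : ∀ s : ℝ, B (∫ _ω' : Ω, A * Real.cos s ∂P) = A * Real.cos s := by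
        intro s
        have : ∫ _ω' : Ω, A * Real.cos s ∂P = A * Real.cos s := by
          rw [integral_const]; simp
        rw [this]
        exact hB _ (hmul _ (Real.abs_cos_le_one s))
      simp only [h1]
      rw [intervalIntegral.integral_const_mul, integral_cos]
      simp
    · have h2 : ∫ s in t..(Real.pi / 4), F (∫ ω', (A * Real.sin s + W s ω') ∂P)
          = ∫ s in t..(Real.pi / 4), A * Real.sin s := by
        apply intervalIntegral.integral_congr
        intro s hs
        rw [Set.uIcc_of_le ht.2] at hs
        have hs' : s ∈ Set.Icc (0 : ℝ) (Real.pi / 4) := ⟨ht.1.trans hs.1, hs.2⟩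
        simp only [hmean s hs']
        exact hF _ (hmul _ (Real.abs_sin_le_one s))
      rw [h2, hmean _ ⟨hpi, le_rfl⟩, hG _ (hmul _ (Real.abs_sin_le_one _)),
        intervalIntegral.integral_const_mul, integral_sin, Real.sin_pi_div_four,
        Real.cos_pi_div_four]
      ring
  refine ⟨fun t ω => 0 * Real.sin t + W t ω, fun t _ => 0 * Real.cos t,
    fun t ω => R * Real.sin t + W t ω, fun t _ => R * Real.cos t,
    key 0 (by simpa using hR.le), key R (abs_of_pos hR).le, ?_, ?_, ?_⟩
  · intro ω
    simp [hW0]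
  · intro ω
    simp [hW0]
  · simpa using hR.ne
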